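/- On a probability space, let X₁, X₂, … be nonnegative random variables with common survival function P(Xᵢ > x) = x^{-α} l(x) for all x > 0, where α ∈ (0,1) and l is slowly varying at infinity. Suppose Condition A(1) holds and that for some a > 0, ∑_{1≤i,j≤n, i≠j} Cov(1(Xᵢ ≤ a), 1(Xⱼ ≤ a)) = o(n²). Then for every h > 0, log M^{−*}_{n,h}/log M_{n,1} − h = O_p(1/log n) as n → ∞. -/

import Mathlib

open MeasureTheory Filter

noncomputable section

/-- `l` is slowly varying at infinity: for every `lam > 0`, `l(lam*x)/l(x) → 1` as `x → ∞`. -/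
def SlowlyVarying (l : ℝ → ℝ) : Prop :=
  ∀ lam : ℝ, 0 < lam → Tendsto (fun x => l (lam * x) / l x) atTop (nhds 1)

/-- Covariance `Cov(U,V) = E[UV] - E[U]E[V]`. -/
def cov {Ω : Type*} [MeasurableSpace Ω] (μ : Measure Ω) (U V : Ω → ℝ) : ℝ :=
  (∫ ω, U ω * V ω ∂μ) - (∫ ω, U ω ∂μ) * (∫ ω, V ω ∂μ)

/-- Truncation `X·1(X < t)`. -/
def trunc {Ω : Type*} (X : Ω → ℝ) (t : ℝ) : Ω → ℝ :=
  fun ω => if X ω < t then X ω else 0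

/-- Sum of covariances of `p`-th powers of the variables truncated at `v n`,
over distinct pairs of indices among the first `n`. -/
def covSum {Ω : Type*} [MeasurableSpace Ω] (μ : Measure Ω) (X : ℕ → Ω → ℝ)
    (v : ℕ → ℝ) (p : ℝ) (n : ℕ) : ℝ :=
  ∑ i ∈ Finset.range n, ∑ j ∈ Finset.range n,
    if i = j then 0
    else cov μ (fun ω => trunc (X i) (v n) ω ^ p) (fun ω => trunc (X j) (v n) ω ^ p)

/-- Condition A(p). -/
def ConditionA {Ω : Type*} [MeasurableSpace Ω] (μ : Measure Ω) (X : ℕ → Ω → ℝ)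
    (v c : ℕ → ℝ) (p : ℝ) : Prop :=
  Tendsto (fun n => covSum μ X v p n / (v n ^ (2 * p) * c n ^ 2)) atTop (nhds 0)

/-- `p`-th sample moment `M_{n,p}`. -/
def sampleMoment {Ω : Type*} (X : ℕ → Ω → ℝ) (p : ℝ) (n : ℕ) (ω : Ω) : ℝ :=
  (n : ℝ)⁻¹ * ∑ i ∈ Finset.range n, X i ω ^ p

/-- `Y_n = O_p(r_n)`. -/
def IsOp {Ω : Type*} [MeasurableSpace Ω] (μ : Measure Ω) (Y : ℕ → Ω → ℝ) (r : ℕ → ℝ) : Prop :=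
  ∀ ε : ℝ, 0 < ε → ∃ C : ℝ, 0 < C ∧
    ∀ᶠ n in atTop, (μ {ω | C * r n < |Y n ω|}).toReal < ε

/-- Convergence in probability to a constant. -/
def TendstoInProbability {Ω : Type*} [MeasurableSpace Ω] (μ : Measure Ω)
    (Y : ℕ → Ω → ℝ) (a : ℝ) : Prop :=
  ∀ ε : ℝ, 0 < ε → Tendsto (fun n => (μ {ω | ε < |Y n ω - a|}).toReal) atTop (nhds 0)

/-- Number of sample points not exceeding the sample mean, `N⁻_n` (as a real number). -/
def Nminus {Ω : Type*} (X : ℕ → Ω → ℝ) (n : ℕ) (ω : Ω) : ℝ :=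
  ∑ i ∈ Finset.range n, if X i ω ≤ sampleMoment X 1 n ω then (1 : ℝ) else 0

/-- `h`-th sample central local lower moment `M^{−*}_{n,h}`. -/
def localLowerMoment {Ω : Type*} (X : ℕ → Ω → ℝ) (h : ℝ) (n : ℕ) (ω : Ω) : ℝ :=
  (Nminus X n ω)⁻¹ * ∑ i ∈ Finset.range n, max (sampleMoment X 1 n ω - X i ω) 0 ^ h


lemma aux_potter (G : ℝ → ℝ) (hpos : ∀ x, 0 < x → 0 < G x)
    (hanti : ∀ x y, 0 < x → x ≤ y → G y ≤ G x) (α β : ℝ) (hβ0 : 0 < β) (hαβ : α < β)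
    (hG : Tendsto (fun x => G (2 * x) / G x) atTop (nhds ((2:ℝ) ^ (-α)))) :
    ∃ C x0 : ℝ, 0 < C ∧ 0 < x0 ∧ ∀ x, x0 ≤ x → C * x ^ (-β) ≤ G x := by
  have hlt : (2:ℝ) ^ (-β) < (2:ℝ) ^ (-α) :=
    Real.rpow_lt_rpow_of_exponent_lt (by norm_num) (by linarith)
  obtain ⟨x1, hx1⟩ := eventually_atTop.1 (hG.eventually (lt_mem_nhds hlt))
  set x0 := max x1 1 with hx0
  have hx0pos : 0 < x0 := lt_of_lt_of_le one_pos (le_max_right _ _)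
  have hstep : ∀ x, x0 ≤ x → (2:ℝ) ^ (-β) * G x ≤ G (2 * x) := by
    intro x hx
    have h1 := hx1 x (le_trans (le_max_left _ _) hx)
    have h2 := hpos x (lt_of_lt_of_le hx0pos hx)
    exact ((lt_div_iff₀ h2).1 h1).le
  have hiter : ∀ k : ℕ, ((2:ℝ) ^ (-β)) ^ k * G x0 ≤ G (2 ^ k * x0) := by
    intro k
    induction k with
    | zero => simp
    | succ k ih =>
      have h1 : x0 ≤ 2 ^ k * x0 := by
        have : (1:ℝ) ≤ 2 ^ k := one_le_pow₀ (by norm_num)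
        nlinarith
      have h2 := hstep _ h1
      have h3 : (0:ℝ) < (2:ℝ) ^ (-β) := by positivity
      calc ((2:ℝ) ^ (-β)) ^ (k+1) * G x0 = (2:ℝ) ^ (-β) * (((2:ℝ) ^ (-β)) ^ k * G x0) := by ring
        _ ≤ (2:ℝ) ^ (-β) * G (2 ^ k * x0) := by gcongr
        _ ≤ G (2 * (2 ^ k * x0)) := h2
        _ = _ := by congr 1; ring
  refine ⟨(2:ℝ) ^ (-β) * G x0 * x0 ^ β, x0, ?_, hx0pos, ?_⟩
  · have := hpos x0 hx0pos
    positivity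
  intro x hx
  have hxpos : 0 < x := lt_of_lt_of_le hx0pos hx
  obtain ⟨k, hk1, hk2⟩ := exists_nat_pow_near (x := x / x0) (y := 2) ((one_le_div hx0pos).2 hx) (by norm_num)
  have h1 : G (2 ^ (k+1) * x0) ≤ G x := hanti _ _ hxpos ((div_lt_iff₀ hx0pos).1 hk2).le
  have h2 : (2:ℝ) ^ k * x0 ≤ x := (le_div_iff₀ hx0pos).1 hk1
  have hk0 : (0:ℝ) < 2 ^ k * x0 := by positivity
  have h3 : x ^ (-β) ≤ ((2:ℝ) ^ k * x0) ^ (-β) :=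
    Real.rpow_le_rpow_of_nonpos hk0 h2 (by linarith)
  have h4 : ((2:ℝ) ^ k * x0) ^ (-β) = ((2:ℝ) ^ (-β)) ^ k * x0 ^ (-β) := by
    rw [Real.mul_rpow (by positivity) hx0pos.le, ← Real.rpow_natCast, ← Real.rpow_natCast,
      ← Real.rpow_mul (by norm_num), ← Real.rpow_mul (by norm_num)]
    congr 2; ring
  have h5 : x0 ^ β * x0 ^ (-β) = 1 := by
    rw [← Real.rpow_add hx0pos]; simp
  have hGx := hpos x0 hx0pos
  calc (2:ℝ) ^ (-β) * G x0 * x0 ^ β * x ^ (-β)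
      ≤ (2:ℝ) ^ (-β) * G x0 * x0 ^ β * (((2:ℝ) ^ (-β)) ^ k * x0 ^ (-β)) := by
        rw [← h4]; gcongr
    _ = ((2:ℝ) ^ (-β)) ^ (k+1) * G x0 * (x0 ^ β * x0 ^ (-β)) := by ring
    _ = ((2:ℝ) ^ (-β)) ^ (k+1) * G x0 := by rw [h5, mul_one]
    _ ≤ _ := (hiter (k+1)).trans h1

lemma aux_det {Ω : Type*} (X : ℕ → Ω → ℝ) (hXnn : ∀ i ω, 0 ≤ X i ω) (h : ℝ) (hh : 0 < h)
    (n : ℕ) (hn : 2 ≤ n) (ω : Ω) (K δ : ℝ) (hδ : 0 < δ) (hK : 0 < K)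
    (hcount : (∑ i ∈ Finset.range n, if K < X i ω then (1:ℝ) else 0) ≤ n / 2)
    (hM : (n:ℝ) ^ δ ≤ sampleMoment X 1 n ω) (hMK : 2 * K ≤ sampleMoment X 1 n ω) :
    |Real.log (localLowerMoment X h n ω) / Real.log (sampleMoment X 1 n ω) - h|
      ≤ ((1 + h) * Real.log 2 / δ) * (1 / Real.log n) := by
  set M := sampleMoment X 1 n ω with hMdef
  have hn' : (2:ℝ) ≤ n := by exact_mod_cast hn
  have hlogn : 0 < Real.log n := Real.log_pos (by linarith)
  have hMpos : 0 < M := by linarith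
  have hlogM : δ * Real.log n ≤ Real.log M := by
    rw [← Real.log_rpow (by linarith)]
    exact Real.log_le_log (by positivity) hM
  have hlogMpos : 0 < Real.log M := lt_of_lt_of_le (by positivity) hlogM
  have hcount2 : (n:ℝ) / 2 ≤ ∑ i ∈ Finset.range n, if X i ω ≤ K then (1:ℝ) else 0 := by
    have : (∑ i ∈ Finset.range n, if K < X i ω then (1:ℝ) else 0)
        + (∑ i ∈ Finset.range n, if X i ω ≤ K then (1:ℝ) else 0) = n := by
      rw [← Finset.sum_add_distrib]
      have : ∀ i ∈ Finset.range n, ((if K < X i ω then (1:ℝ) else 0)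
          + if X i ω ≤ K then (1:ℝ) else 0) = 1 := by
        intro i _
        by_cases hc : K < X i ω
        · simp [hc, not_le.2 hc]
        · simp [hc, not_lt.1 hc]
      rw [Finset.sum_congr rfl this]; simp
    linarith
  have hNge : (n:ℝ) / 2 ≤ Nminus X n ω := by
    refine hcount2.trans ?_
    unfold Nminus
    apply Finset.sum_le_sum
    intro i _
    by_cases hc : X i ω ≤ K
    · have : X i ω ≤ sampleMoment X 1 n ω := by rw [← hMdef]; linarith
      simp [hc, this]
    · rw [if_neg hc]; split_ifs <;> norm_num
  have hNle : Nminus X n ω ≤ n := by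
    unfold Nminus
    calc _ ≤ ∑ i ∈ Finset.range n, (1:ℝ) := by
          apply Finset.sum_le_sum; intro i _; split_ifs <;> norm_num
      _ = n := by simp
  have hNpos : 0 < Nminus X n ω := by linarith
  have hup : localLowerMoment X h n ω ≤ M ^ h := by
    unfold localLowerMoment
    rw [inv_mul_le_iff₀ hNpos, ← hMdef]
    unfold Nminus
    rw [Finset.sum_mul]
    apply Finset.sum_le_sum
    intro i _
    rw [← hMdef]
    by_cases hc : X i ω ≤ M
    · rw [if_pos hc, one_mul, max_eq_left (by linarith)]
      exact Real.rpow_le_rpow (by linarith) (by linarith [hXnn i ω]) hh.le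
    · rw [if_neg hc, max_eq_right (by linarith), Real.zero_rpow hh.ne']; simp
  have hlow : (1/2) * (M/2) ^ h ≤ localLowerMoment X h n ω := by
    unfold localLowerMoment
    rw [le_inv_mul_iff₀ hNpos, ← hMdef]
    calc Nminus X n ω * ((1/2) * (M/2) ^ h) ≤ n * ((1/2) * (M/2) ^ h) := by gcongr
      _ = (n / 2) * (M/2) ^ h := by ring
      _ ≤ (∑ i ∈ Finset.range n, if X i ω ≤ K then (1:ℝ) else 0) * (M/2) ^ h := by gcongr
      _ ≤ _ := by
        rw [Finset.sum_mul]
        apply Finset.sum_le_sum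
        intro i _
        by_cases hc : X i ω ≤ K
        · rw [if_pos hc, one_mul]
          exact Real.rpow_le_rpow (by linarith) (le_trans (by linarith) (le_max_left _ _)) hh.le
        · rw [if_neg hc, zero_mul]; positivity
  have hLpos : 0 < localLowerMoment X h n ω := lt_of_lt_of_le (by positivity) hlow
  have hlup : Real.log (localLowerMoment X h n ω) ≤ h * Real.log M := by
    rw [← Real.log_rpow hMpos]; exact Real.log_le_log hLpos hup
  have hllow : h * Real.log M - (1+h) * Real.log 2 ≤ Real.log (localLowerMoment X h n ω) := by
    have := Real.log_le_log (by positivity) hlow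
    rw [Real.log_mul (by norm_num) (by positivity), Real.log_rpow (by positivity),
      Real.log_div hMpos.ne' (by norm_num), Real.log_div (by norm_num) (by norm_num), Real.log_one] at this
    linarith
  have hl2 : 0 < Real.log 2 := Real.log_pos (by norm_num)
  have e1 : Real.log (localLowerMoment X h n ω) / Real.log M - h
      = (Real.log (localLowerMoment X h n ω) - h * Real.log M) / Real.log M := by
    field_simp
  rw [e1, abs_div, abs_of_pos hlogMpos, abs_of_nonpos (by linarith)]
  calc _ ≤ (1+h) * Real.log 2 / (δ * Real.log n) := by
        apply div_le_div₀ (by positivity) (by linarith) (by positivity) hlogM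
    _ = _ := by field_simp

lemma aux_cov {Ω : Type*} [MeasurableSpace Ω] (μ : Measure Ω) [IsProbabilityMeasure μ]
    (Z : ℕ → Ω → ℝ) (hZm : ∀ i, Measurable (Z i)) (v : ℝ) (hZ0 : ∀ i ω, 0 ≤ Z i ω)
    (hZv : ∀ i ω, Z i ω ≤ v) (n : ℕ) (hE : 0 < ∑ i ∈ Finset.range n, ∫ ω, Z i ω ∂μ) :
    (μ {ω | ∑ i ∈ Finset.range n, Z i ω < (∑ i ∈ Finset.range n, ∫ ω, Z i ω ∂μ) / 2}).toReal
     ≤ 4 * (v * (∑ i ∈ Finset.range n, ∫ ω, Z i ω ∂μ)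
        + ∑ i ∈ Finset.range n, ∑ j ∈ Finset.range n, if i = j then 0 else cov μ (Z i) (Z j))
        / (∑ i ∈ Finset.range n, ∫ ω, Z i ω ∂μ) ^ 2 := by
  set E := ∑ i ∈ Finset.range n, ∫ ω, Z i ω ∂μ with hEdef
  have hLp : ∀ i, MemLp (Z i) 2 μ := fun i =>
    MemLp.of_bound (hZm i).aestronglyMeasurable v (by
      filter_upwards with ω
      rw [Real.norm_eq_abs, abs_of_nonneg (hZ0 i ω)]; exact hZv i ω)
  have hInt : ∀ i, Integrable (Z i) μ := fun i => (hLp i).integrable (by norm_num)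
  have hcovc : ∀ i j, ProbabilityTheory.covariance (Z i) (Z j) μ = cov μ (Z i) (Z j) := by
    intro i j
    rw [ProbabilityTheory.covariance_eq_sub (hLp i) (hLp j)]; rfl
  have hSL : MemLp (∑ i ∈ Finset.range n, Z i) 2 μ := memLp_finsetSum' _ fun i _ => hLp i
  have hSE : ∫ ω, (∑ i ∈ Finset.range n, Z i) ω ∂μ = E := by
    simp only [Finset.sum_apply]
    rw [integral_finsetSum _ fun i _ => hInt i]
  have hvar : ProbabilityTheory.variance (∑ i ∈ Finset.range n, Z i) μ
      = ∑ i ∈ Finset.range n, ∑ j ∈ Finset.range n, cov μ (Z i) (Z j) := by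
    rw [← ProbabilityTheory.covariance_self hSL.aemeasurable,
      ProbabilityTheory.covariance_sum_sum' (fun i _ => hLp i) (fun i _ => hLp i)]
    simp only [hcovc]
  have hdiag : ∀ i, cov μ (Z i) (Z i) ≤ v * ∫ ω, Z i ω ∂μ := by
    intro i
    unfold cov
    have h1 : ∫ ω, Z i ω * Z i ω ∂μ ≤ ∫ ω, v * Z i ω ∂μ := by
      apply integral_mono ((hLp i).integrable_mul (hLp i)) ((hInt i).const_mul v)
      intro ω
      exact mul_le_mul_of_nonneg_right (hZv i ω) (hZ0 i ω)
    rw [integral_const_mul] at h1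
    nlinarith [mul_self_nonneg (∫ ω, Z i ω ∂μ)]
  have hvle : ProbabilityTheory.variance (∑ i ∈ Finset.range n, Z i) μ ≤ v * E +
      ∑ i ∈ Finset.range n, ∑ j ∈ Finset.range n, if i = j then 0 else cov μ (Z i) (Z j) := by
    rw [hvar, hEdef, Finset.mul_sum, ← Finset.sum_add_distrib]
    apply Finset.sum_le_sum
    intro i hi
    have : ∑ j ∈ Finset.range n, cov μ (Z i) (Z j) = cov μ (Z i) (Z i)
        + ∑ j ∈ Finset.range n, if i = j then 0 else cov μ (Z i) (Z j) := by
      have h2 : ∀ j ∈ Finset.range n, cov μ (Z i) (Z j) =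
          (if i = j then cov μ (Z i) (Z i) else 0) + if i = j then 0 else cov μ (Z i) (Z j) := by
        intro j _
        by_cases hij : i = j
        · subst hij; simp
        · simp [hij]
      rw [Finset.sum_congr rfl h2, Finset.sum_add_distrib, Finset.sum_ite_eq, if_pos hi]
    rw [this]
    linarith [hdiag i]
  have hcheb := ProbabilityTheory.meas_ge_le_variance_div_sq hSL (c := E / 2) (by positivity)
  rw [hSE] at hcheb
  have hsub : {ω | ∑ i ∈ Finset.range n, Z i ω < E / 2} ⊆
      {ω | E / 2 ≤ |(∑ i ∈ Finset.range n, Z i) ω - E|} := by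
    intro ω hω
    simp only [Set.mem_ofPred_eq, Finset.sum_apply] at hω ⊢
    rw [abs_sub_comm]
    exact le_trans (by linarith) (le_abs_self _)
  have h3 := ENNReal.toReal_mono ENNReal.ofReal_ne_top ((measure_mono hsub).trans hcheb)
  rw [ENNReal.toReal_ofReal (div_nonneg (ProbabilityTheory.variance_nonneg _ _) (by positivity))] at h3
  refine h3.trans ?_
  rw [div_le_div_iff₀ (by positivity) (by positivity)]
  have : 0 < E ^ 2 := by positivity
  nlinarith

lemma aux_markov {Ω : Type*} [MeasurableSpace Ω] (μ : Measure Ω) [IsProbabilityMeasure μ]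
    (X : ℕ → Ω → ℝ) (hXm : ∀ i, Measurable (X i)) (K g : ℝ)
    (hg : ∀ i, (μ {ω | K < X i ω}).toReal = g) (n : ℕ) (hn : 0 < n) :
    (μ {ω | (n:ℝ) / 2 < ∑ i ∈ Finset.range n, if K < X i ω then (1:ℝ) else 0}).toReal ≤ 2 * g := by
  have hn' : (0:ℝ) < n := by exact_mod_cast hn
  have hms : ∀ i, MeasurableSet {ω | K < X i ω} := fun i => measurableSet_lt measurable_const (hXm i)
  have heq : ∀ i, (fun ω => if K < X i ω then (1:ℝ) else 0) = Set.indicator {ω | K < X i ω} (fun _ => (1:ℝ)) := by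
    intro i; ext ω; simp [Set.indicator]
  have hint : ∀ i, Integrable (fun ω => if K < X i ω then (1:ℝ) else 0) μ := by
    intro i; rw [heq]; exact (integrable_const _).indicator (hms i)
  have hI : ∫ ω, (∑ i ∈ Finset.range n, if K < X i ω then (1:ℝ) else 0) ∂μ = n * g := by
    rw [integral_finsetSum _ fun i _ => hint i]
    have : ∀ i ∈ Finset.range n, ∫ ω, (if K < X i ω then (1:ℝ) else 0) ∂μ = g := by
      intro i _
      rw [heq, integral_indicator (hms i)]
      simp [measureReal_def, hg i]
    rw [Finset.sum_congr rfl this]; simp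
  have h1 := mul_meas_ge_le_integral_of_nonneg (μ := μ)
    (f := fun ω => ∑ i ∈ Finset.range n, if K < X i ω then (1:ℝ) else 0)
    (by filter_upwards with ω; exact Finset.sum_nonneg fun i _ => by split_ifs <;> norm_num)
    (integrable_finsetSum _ fun i _ => hint i) ((n:ℝ)/2)
  rw [hI] at h1
  have h2 : (μ {ω | (n:ℝ) / 2 < ∑ i ∈ Finset.range n, if K < X i ω then (1:ℝ) else 0}).toReal
     ≤ μ.real {ω | (n:ℝ) / 2 ≤ ∑ i ∈ Finset.range n, if K < X i ω then (1:ℝ) else 0} :=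
    ENNReal.toReal_mono (measure_ne_top _ _) (measure_mono fun ω hω => by
      simp only [Set.mem_ofPred_eq] at hω ⊢; exact hω.le)
  refine h2.trans ?_
  by_contra hcon
  push Not at hcon
  have := mul_lt_mul_of_pos_left hcon (half_pos hn')
  nlinarith

lemma aux_trunc {Ω : Type*} [MeasurableSpace Ω] (μ : Measure Ω) [IsProbabilityMeasure μ]
    (X : Ω → ℝ) (hXm : Measurable X) (hX0 : ∀ ω, 0 ≤ X ω) (v : ℝ) (hv : 0 < v) :
    (v / 4) * ((μ {ω | v / 4 < X ω}).toReal - (μ {ω | v / 2 < X ω}).toReal)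
      ≤ ∫ ω, trunc X v ω ∂μ := by
  have hA : MeasurableSet {ω | v / 4 < X ω} := measurableSet_lt measurable_const hXm
  have hB : MeasurableSet {ω | v / 2 < X ω} := measurableSet_lt measurable_const hXm
  have hsub : {ω | v / 2 < X ω} ⊆ {ω | v / 4 < X ω} := by
    intro ω hω; simp only [Set.mem_ofPred_eq] at *; linarith
  have h1 := measureReal_sdiff (μ := μ) hsub hB
  rw [measureReal_def, measureReal_def, measureReal_def] at h1
  rw [← h1]
  have hD := hA.diff hB
  have h2 : ∫ ω, Set.indicator ({ω | v / 4 < X ω} \ {ω | v / 2 < X ω}) (fun _ => v / 4) ω ∂μ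
      ≤ ∫ ω, trunc X v ω ∂μ := by
    apply integral_mono
    · exact (integrable_const _).indicator hD
    · apply Integrable.of_bound (C := v)
      · exact (Measurable.ite (measurableSet_lt hXm measurable_const) hXm measurable_const).aestronglyMeasurable
      · filter_upwards with ω
        unfold trunc
        split_ifs with h
        · rw [Real.norm_eq_abs, abs_of_nonneg (hX0 ω)]; exact h.le
        · simpa using hv.le
    · intro ω
      simp only [Set.indicator, trunc, Set.mem_sdiff, Set.mem_ofPred_eq]
      split_ifs with h h' h'
      · exact h.1.le
      · exfalso; linarith [h.2]
      · exact hX0 ω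
      · exact le_rfl
  rw [integral_indicator hD] at h2
  simp [measureReal_def] at h2
  linarith

set_option maxHeartbeats 1000000 in
/-- **Theorem (h-th local central lower moments).** -/
theorem local_central_lower_moments
    {Ω : Type*} [MeasurableSpace Ω] (μ : Measure Ω) [IsProbabilityMeasure μ]
    (X : ℕ → Ω → ℝ) (hXmeas : ∀ i, Measurable (X i)) (hXnn : ∀ i ω, 0 ≤ X i ω)
    (α : ℝ) (hα : 0 < α) (hα1 : α < 1)
    (l : ℝ → ℝ) (hlpos : ∀ x : ℝ, 0 < x → 0 < l x) (hl : SlowlyVarying l)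
    (hsurv : ∀ i, ∀ x : ℝ, 0 < x → (μ {ω | x < X i ω}).toReal = x ^ (-α) * l x)
    (c : ℕ → ℝ) (hc : ∀ n, 0 < c n) (hctop : Tendsto c atTop atTop)
    (hncmono : Monotone fun n : ℕ => (n : ℝ) * c n)
    (hnctop : Tendsto (fun n : ℕ => (n : ℝ) * c n) atTop atTop)
    (hclog : Tendsto (fun n : ℕ => Real.log (c n) / Real.log n) atTop (nhds 0))
    (v : ℕ → ℝ) (hvpos : ∀ n, 0 < v n)
    (hv : Tendsto (fun n : ℕ => (n : ℝ) * l (v n) / (v n ^ α * c n)) atTop (nhds 1))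
    (hA1 : ConditionA μ X v c 1)
    (a : ℝ) (ha : 0 < a)
    (hind : Tendsto (fun n =>
        (∑ i ∈ Finset.range n, ∑ j ∈ Finset.range n,
          if i = j then 0
          else cov μ (fun ω => if X i ω ≤ a then (1 : ℝ) else 0)
            (fun ω => if X j ω ≤ a then (1 : ℝ) else 0)) / (n : ℝ) ^ 2)
      atTop (nhds 0)) :
    ∀ h : ℝ, 0 < h →
      IsOp μ (fun n ω =>
          Real.log (localLowerMoment X h n ω) / Real.log (sampleMoment X 1 n ω) - h)
        (fun n => 1 / Real.log n) := by
  intro h hh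
  set G : ℝ → ℝ := fun x => x ^ (-α) * l x with hGdef
  have hGpos : ∀ x, 0 < x → 0 < G x := fun x hx =>
    mul_pos (Real.rpow_pos_of_pos hx _) (hlpos x hx)
  have hGanti : ∀ x y, 0 < x → x ≤ y → G y ≤ G x := by
    intro x y hx hxy
    have h1 := hsurv 0 x hx
    have h2 := hsurv 0 y (lt_of_lt_of_le hx hxy)
    change _ = G x at h1
    change _ = G y at h2
    rw [← h1, ← h2]
    refine ENNReal.toReal_mono (measure_ne_top _ _) (measure_mono fun ω hω => ?_)
    simp only [Set.mem_ofPred_eq] at hω ⊢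
    linarith
  have hGrat : ∀ lam : ℝ, 0 < lam →
      Tendsto (fun x => G (lam * x) / G x) atTop (nhds (lam ^ (-α))) := by
    intro lam hlam
    have h1 := (hl lam hlam).const_mul (lam ^ (-α))
    rw [mul_one] at h1
    refine h1.congr' ?_
    filter_upwards [eventually_gt_atTop 0] with x hx
    have hlx := hlpos x hx
    have hxa : 0 < x ^ (-α) := Real.rpow_pos_of_pos hx _
    simp only [hGdef]
    rw [Real.mul_rpow hlam.le hx.le]
    field_simp
  -- bounds along `n`
  have hcn : ∀ᶠ n : ℕ in atTop, c n ≤ (n:ℝ) ^ (1/2 : ℝ) := by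
    filter_upwards [hclog.eventually (gt_mem_nhds (show (0:ℝ) < 1/2 by norm_num)),
      eventually_ge_atTop 2] with n h1 hn
    have hn' : (2:ℝ) ≤ n := by exact_mod_cast hn
    have hlogn : 0 < Real.log n := Real.log_pos (by linarith)
    rw [div_lt_iff₀ hlogn] at h1
    rw [← Real.log_le_log_iff (hc n) (by positivity), Real.log_rpow (by linarith)]
    exact h1.le
  have hvG : ∀ n : ℕ, (n:ℝ) * l (v n) / (v n ^ α * c n) = n * G (v n) / c n := by
    intro n
    have h1 := hvpos n
    have h2 := hc n
    simp only [hGdef]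
    rw [Real.rpow_neg h1.le]
    field_simp
  simp only [hvG] at hv
  have hGlo : ∀ᶠ n : ℕ in atTop, c n ≤ 2 * (n * G (v n)) := by
    filter_upwards [hv.eventually (lt_mem_nhds (show (1/2:ℝ) < 1 by norm_num))] with n h1
    rw [lt_div_iff₀ (hc n)] at h1
    linarith
  have hGhi : ∀ᶠ n : ℕ in atTop, n * G (v n) ≤ 2 * c n := by
    filter_upwards [hv.eventually (gt_mem_nhds (show (1:ℝ) < 2 by norm_num))] with n h1
    rw [div_lt_iff₀ (hc n)] at h1
    linarith
  have hnpow : ∀ s : ℝ, 0 < s → Tendsto (fun n : ℕ => (n:ℝ) ^ s) atTop atTop := fun s hs =>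
    (tendsto_rpow_atTop hs).comp tendsto_natCast_atTop_atTop
  have hGsmall : ∀ η : ℝ, 0 < η → ∀ᶠ n : ℕ in atTop, G (v n) < η := by
    intro η hη
    filter_upwards [hGhi, hcn, (hnpow (1/2) (by norm_num)).eventually_gt_atTop (2 / η),
      eventually_ge_atTop 1] with n h1 h2 h3 hn
    have hn' : (1:ℝ) ≤ n := by exact_mod_cast hn
    set r := (n:ℝ) ^ (1/2:ℝ) with hr
    have hr0 : 0 < r := by positivity
    have hrr : r * r = n := by
      rw [hr, ← Real.rpow_add (by linarith)]; norm_num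
    rw [div_lt_iff₀ hη] at h3
    have h4 : r * (r * G (v n)) ≤ r * 2 := by rw [← mul_assoc, hrr]; linarith
    have h5 := le_of_mul_le_mul_left h4 hr0
    exact lt_of_mul_lt_mul_left (lt_of_le_of_lt h5 h3) hr0.le
  have hvtop : Tendsto v atTop atTop := by
    rw [tendsto_atTop]
    intro B
    have hB : 0 < max B 1 := lt_of_lt_of_le one_pos (le_max_right _ _)
    filter_upwards [hGsmall _ (hGpos _ hB)] with n h1
    by_contra hcon
    push Not at hcon
    exact absurd (hGanti (v n) (max B 1) (hvpos n) (hcon.le.trans (le_max_left _ _))) (not_le.2 h1)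
  -- truncated mean
  set q : ℝ := (1/4:ℝ) ^ (-α) - (1/2:ℝ) ^ (-α) with hq
  have hq0 : 0 < q := by
    have : (1/2:ℝ) ^ (-α) < (1/4:ℝ) ^ (-α) :=
      Real.rpow_lt_rpow_of_neg (by norm_num) (by norm_num) (by linarith)
    linarith
  have hdiff : ∀ᶠ x : ℝ in atTop, q / 2 * G x ≤ G (x / 4) - G (x / 2) := by
    have h1 := (hGrat (1/4) (by norm_num)).sub (hGrat (1/2) (by norm_num))
    filter_upwards [h1.eventually (lt_mem_nhds (show q / 2 < q by linarith)),
      eventually_gt_atTop 0] with x h2 hx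
    have hGx := hGpos x hx
    rw [← sub_div, lt_div_iff₀ hGx] at h2
    rw [show x / 4 = 1/4 * x by ring, show x / 2 = 1/2 * x by ring]
    exact h2.le
  set κ : ℝ := q / 16 with hκ
  have hκ0 : 0 < κ := by positivity
  have hE : ∀ᶠ n : ℕ in atTop,
      κ * (v n * c n) ≤ ∑ i ∈ Finset.range n, ∫ ω, trunc (X i) (v n) ω ∂μ := by
    filter_upwards [hvtop.eventually hdiff, hGlo] with n h1 h2
    have hvn := hvpos n
    have h3 : ∀ i ∈ Finset.range n, v n / 4 * (q / 2 * G (v n)) ≤ ∫ ω, trunc (X i) (v n) ω ∂μ := by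
      intro i _
      have h4 := aux_trunc μ (X i) (hXmeas i) (hXnn i) (v n) hvn
      rw [hsurv i _ (by positivity), hsurv i _ (by positivity)] at h4
      refine le_trans ?_ h4
      exact mul_le_mul_of_nonneg_left h1 (by positivity)
    refine le_trans ?_ (Finset.sum_le_sum h3)
    rw [Finset.sum_const, Finset.card_range, nsmul_eq_mul]
    have h5 := mul_le_mul_of_nonneg_left h2 (show 0 ≤ κ * v n by positivity)
    calc κ * (v n * c n) = κ * v n * c n := by ring
      _ ≤ _ := h5
      _ = _ := by rw [hκ]; ring
  -- growth of `v`
  obtain ⟨β, hαβ, hβ1⟩ := exists_between hα1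
  have hβ0 : 0 < β := hα.trans hαβ
  obtain ⟨C, x0, hC, hx0, hpot⟩ := aux_potter G hGpos hGanti α β hβ0 hαβ (hGrat 2 (by norm_num))
  set γ : ℝ := (1/β - 1) / 2 with hγ
  have hγ0 : 0 < γ := by
    have : 1 < 1 / β := by rw [lt_div_iff₀ hβ0]; linarith
    rw [hγ]; linarith
  set D : ℝ := (C / 2) ^ (1/β) with hD
  have hD0 : 0 < D := by positivity
  have hgrow : ∀ᶠ n : ℕ in atTop, D * (n:ℝ) ^ γ * n ≤ v n * c n := by
    filter_upwards [hvtop.eventually_ge_atTop x0, hGhi, hcn, eventually_ge_atTop 1]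
      with n h1 h2 h3 hn
    have hn' : (1:ℝ) ≤ n := by exact_mod_cast hn
    have hn0 : (0:ℝ) < n := by linarith
    have hcp := hc n
    have hvp := hvpos n
    have h4 := hpot (v n) h1
    set u : ℝ := n / c n with hu
    have hu0 : 0 < u := by positivity
    have huc : u * c n = n := by rw [hu]; field_simp
    have h5 : C / 2 * u ≤ v n ^ β := by
      have h6 : v n ^ (-β) * v n ^ β = 1 := by rw [← Real.rpow_add hvp]; simp
      have hvb : 0 < v n ^ β := by positivity
      have h7 : (n:ℝ) * (C * v n ^ (-β)) ≤ 2 * c n :=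
        (mul_le_mul_of_nonneg_left h4 hn0.le).trans h2
      have h8 := mul_le_mul_of_nonneg_right h7 hvb.le
      have h9 : (n:ℝ) * (C * v n ^ (-β)) * v n ^ β = n * C := by
        rw [← mul_one ((n:ℝ) * C), ← h6]; ring
      rw [h9, ← huc] at h8
      have h10 : c n * (C / 2 * u) ≤ c n * v n ^ β := by linarith
      exact le_of_mul_le_mul_left h10 hcp
    have h6 : D * u ^ (1/β) ≤ v n := by
      have h7 := Real.rpow_le_rpow (by positivity) h5 (show 0 ≤ 1/β by positivity)
      rw [← Real.rpow_mul hvp.le, mul_one_div_cancel hβ0.ne', Real.rpow_one,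
        Real.mul_rpow (by positivity) hu0.le] at h7
      exact h7
    have hur : (n:ℝ) ^ (1/2:ℝ) ≤ u := by
      rw [hu, le_div_iff₀ hcp]
      calc (n:ℝ) ^ (1/2:ℝ) * c n ≤ (n:ℝ) ^ (1/2:ℝ) * (n:ℝ) ^ (1/2:ℝ) := by gcongr
        _ = n := by rw [← Real.rpow_add hn0]; norm_num
    have h7 : (n:ℝ) ^ γ ≤ u ^ (1/β - 1) := by
      have h8 := Real.rpow_le_rpow (by positivity) hur (show 0 ≤ 1/β - 1 by rw [hγ] at hγ0; linarith)
      rw [← Real.rpow_mul hn0.le] at h8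
      rw [hγ, show (1/β - 1)/2 = 1/2 * (1/β-1) by ring]
      exact h8
    have h8 : u ^ (1/β) = u ^ (1/β - 1) * u := by
      rw [Real.rpow_sub_one hu0.ne']; field_simp
    calc D * (n:ℝ) ^ γ * n = D * ((n:ℝ) ^ γ * u) * c n := by rw [← huc]; ring
      _ ≤ D * (u ^ (1/β - 1) * u) * c n := by gcongr
      _ = D * u ^ (1/β) * c n := by rw [h8]
      _ ≤ v n * c n := by gcongr
  have hδ0 : 0 < γ / 2 := by positivity
  -- main
  intro ε hε
  obtain ⟨n0, hn0⟩ := (hGsmall (ε / 4) (by positivity)).exists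
  set K := v n0 with hK
  have hK0 : 0 < K := hvpos n0
  have hl2 : 0 < Real.log 2 := Real.log_pos (by norm_num)
  refine ⟨(1 + h) * Real.log 2 / (γ / 2), by positivity, ?_⟩
  have hA := hA1.eventually (gt_mem_nhds (show (0:ℝ) < κ ^ 2 * ε / 16 by positivity))
  filter_upwards [hA, hE, hgrow, hctop.eventually_gt_atTop (16 / (κ * ε)),
    (hnpow (γ/2) hδ0).eventually_ge_atTop (2 * K),
    (hnpow (γ/2) hδ0).eventually_ge_atTop (2 / (κ * D)), eventually_ge_atTop 2]
    with n hA hE hgrow hcbig hnK hnD hn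
  have hn' : (2:ℝ) ≤ n := by exact_mod_cast hn
  have hnpos : (0:ℝ) < n := by linarith
  have hcp := hc n
  have hvp := hvpos n
  set E := ∑ i ∈ Finset.range n, ∫ ω, trunc (X i) (v n) ω ∂μ with hEdef
  have hvc : 0 < v n * c n := by positivity
  have hE0 : 0 < E := lt_of_lt_of_le (by positivity) hE
  have hZ0 : ∀ i ω, 0 ≤ trunc (X i) (v n) ω := by
    intro i ω; unfold trunc; split_ifs
    · exact hXnn i ω
    · exact le_rfl
  have hch := aux_cov μ (fun i => trunc (X i) (v n))
    (fun i => Measurable.ite (measurableSet_lt (hXmeas i) measurable_const) (hXmeas i)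
      measurable_const) (v n) hZ0
    (by
      intro i ω; unfold trunc; split_ifs with hlt
      · exact hlt.le
      · exact hvp.le) n hE0
  have hcs : covSum μ X v 1 n = ∑ i ∈ Finset.range n, ∑ j ∈ Finset.range n,
      if i = j then 0 else cov μ (trunc (X i) (v n)) (trunc (X j) (v n)) := by
    unfold covSum
    simp only [Real.rpow_one]
  rw [← hcs, ← hEdef] at hch
  have hA' : covSum μ X v 1 n < κ ^ 2 * ε / 16 * (v n * c n) ^ 2 := by
    rw [show (2 * 1 : ℝ) = ((2:ℕ):ℝ) by norm_num, Real.rpow_natCast, ← mul_pow,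
      div_lt_iff₀ (by positivity)] at hA
    exact hA
  have hb1 : (μ {ω | ∑ i ∈ Finset.range n, trunc (X i) (v n) ω < E / 2}).toReal < ε / 2 := by
    refine lt_of_le_of_lt hch ?_
    rw [div_lt_iff₀ (by positivity)]
    have hsq : (κ * (v n * c n)) ^ 2 ≤ E ^ 2 := by gcongr
    have h1 : v n * 16 ≤ E * ε := by
      rw [div_lt_iff₀ (by positivity)] at hcbig
      have := mul_le_mul_of_nonneg_right hE hε.le
      nlinarith
    have h2 : v n * 16 * E ≤ E * ε * E := by gcongr
    nlinarith
  have hb2 : (μ {ω | (n:ℝ) / 2 < ∑ i ∈ Finset.range n, if K < X i ω then (1:ℝ) else 0}).toReal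
      < ε / 2 := by
    have := aux_markov μ X hXmeas K (G K) (fun i => hsurv i K hK0) n (by omega)
    linarith
  have hsub : {ω | (1 + h) * Real.log 2 / (γ / 2) * (1 / Real.log n) <
        |Real.log (localLowerMoment X h n ω) / Real.log (sampleMoment X 1 n ω) - h|} ⊆
      {ω | ∑ i ∈ Finset.range n, trunc (X i) (v n) ω < E / 2} ∪
      {ω | (n:ℝ) / 2 < ∑ i ∈ Finset.range n, if K < X i ω then (1:ℝ) else 0} := by
    intro ω hω
    by_contra hcon
    simp only [Set.mem_union, Set.mem_ofPred_eq, not_or, not_lt] at hcon hω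
    obtain ⟨hc1, hc2⟩ := hcon
    have hM : (n:ℝ) ^ (γ/2) ≤ sampleMoment X 1 n ω := by
      unfold sampleMoment
      rw [le_inv_mul_iff₀ hnpos]
      have h1 : ∑ i ∈ Finset.range n, trunc (X i) (v n) ω ≤
          ∑ i ∈ Finset.range n, X i ω ^ (1:ℝ) := by
        apply Finset.sum_le_sum
        intro i _
        rw [Real.rpow_one]; unfold trunc; split_ifs
        · exact le_rfl
        · exact hXnn i ω
      refine le_trans ?_ h1
      refine le_trans ?_ hc1
      have h2 : (n:ℝ) ^ γ = (n:ℝ) ^ (γ/2) * (n:ℝ) ^ (γ/2) := by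
        rw [← Real.rpow_add hnpos]; congr 1; ring
      rw [div_le_iff₀ (by positivity)] at hnD
      have h3 := mul_le_mul_of_nonneg_left hgrow hκ0.le
      set r := (n:ℝ) ^ (γ/2) with hr
      have hr0 : 0 < r := by positivity
      rw [h2] at h3
      have h4 := mul_le_mul_of_nonneg_left hnD (show 0 ≤ (n:ℝ) * r by positivity)
      have h5 : κ * (D * (r * r) * n) = n * r * (r * (κ * D)) := by ring
      linarith
    exact absurd (aux_det X hXnn h hh n hn ω K (γ/2) hδ0 hK0 hc2 hM (hnK.trans hM)) (not_le.2 hω)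
  calc _ ≤ (μ ({ω | ∑ i ∈ Finset.range n, trunc (X i) (v n) ω < E / 2} ∪
      {ω | (n:ℝ) / 2 < ∑ i ∈ Finset.range n, if K < X i ω then (1:ℝ) else 0})).toReal :=
        ENNReal.toReal_mono (measure_ne_top _ _) (measure_mono hsub)
    _ ≤ _ := measureReal_union_le _ _
    _ < ε := by simp only [measureReal_def]; linarith
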